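/- Let p be a prime and let G be a p-group acting transitively on a set X. Suppose that the orbit numbers of finite-index subgroups are unbounded: for every k ∈ ℕ there exists a finite-index subgroup of G having at least k orbits on X. Then for every M ∈ ℕ there exist a natural number m ≥ M and a subgroup U ≤ G with (G : U) = p^m such that U has at least (p−1)·m + 1 orbits on X. -/

import Mathlib

theorem IsPGroup.exists_le_relIndex_eq_normal {p : ℕ} [Fact p.Prime] {P : Type*} [Group P]
    [Finite P] (hP : IsPGroup p P) {K : Subgroup P} {m : ℕ} (hK : K.index = p ^ (m + 1)) :
    ∃ L : Subgroup P, K ≤ L ∧ L.index = p ^ m ∧ K.relIndex L = p ∧ (K.subgroupOf L).Normal := by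
  have hp : p.Prime := Fact.out
  obtain ⟨n, hn⟩ := IsPGroup.iff_card.mp (hP.to_subgroup K)
  have hcard := K.card_mul_index
  obtain ⟨L, hL, hKL⟩ := Sylow.exists_subgroup_card_pow_succ (p := p) (n := n)
    (by rw [← hcard, hn, hK, ← pow_add]; exact pow_dvd_pow p (by omega)) hn
  have hrel : K.relIndex L = p := by
    have h := Subgroup.card_mul_index (K.subgroupOf L)
    rw [Nat.card_congr (Subgroup.subgroupOfEquivOfLe hKL).toEquiv, hn, hL, pow_succ] at h
    exact Nat.eq_of_mul_eq_mul_left (pow_pos hp.pos n) h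
  refine ⟨L, hKL, ?_, hrel, Subgroup.normal_of_index_eq_minFac_card ?_⟩
  · have h := Subgroup.relIndex_mul_index hKL
    rw [hrel, hK, pow_succ'] at h
    exact Nat.eq_of_mul_eq_mul_left hp.pos h
  · rw [hL, hp.pow_minFac n.succ_ne_zero]
    exact hrel

/-- In a finite `p`-group, a subgroup of index `p ^ m` has at least `(p - 1) * m + 1` double
cosets. -/
theorem IsPGroup.exists_finset_doubleCoset_ne {p : ℕ} [Fact p.Prime] {P : Type*} [Group P]
    [Finite P] (hP : IsPGroup p P) {K : Subgroup P} {m : ℕ} (hK : K.index = p ^ m) :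
    ∃ S : Finset P, (p - 1) * m + 1 ≤ S.card ∧
      ∀ a ∈ S, ∀ b ∈ S, a ≠ b → ∀ k ∈ K, ∀ l ∈ K, a ≠ k * b * l := by
  classical
  have hp : p.Prime := Fact.out
  induction m generalizing K with
  | zero =>
    refine ⟨{1}, by simp, fun a ha b hb hab => ?_⟩
    simp_all
  | succ m ih =>
    obtain ⟨L, hKL, hL, hrel, hnormal⟩ := hP.exists_le_relIndex_eq_normal hK
    obtain ⟨S, hS, hSL⟩ := ih hL
    have : Fintype (L ⧸ K.subgroupOf L) := Fintype.ofFinite _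
    let r : L ⧸ K.subgroupOf L → P := fun q => (q.out : P)
    have hr : Function.Injective r := Subtype.val_injective.comp Quotient.out_injective
    let T : Finset P := Finset.univ.image r
    have hT : T.card = p := by
      rw [Finset.card_image_of_injective _ hr, Finset.card_univ, ← Nat.card_eq_fintype_card]
      exact hrel
    have hTL : ∀ a ∈ T, a ∈ L := by
      intro a ha
      obtain ⟨q, -, rfl⟩ := Finset.mem_image.mp ha
      exact q.out.2
    have hS_in : (S.filter (· ∈ L)).card ≤ 1 := by
      refine Finset.card_le_one.mpr fun a ha b hb => ?_
      rw [Finset.mem_filter] at ha hb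
      by_contra hab
      exact hSL a ha.1 b hb.1 hab _ (L.mul_mem ha.2 (L.inv_mem hb.2)) 1 L.one_mem (by group)
    have hS_split := S.card_filter_add_card_filter_not (· ∈ L)
    have hdisj : Disjoint (S.filter (· ∉ L)) T :=
      Finset.disjoint_left.mpr fun a ha haT => (Finset.mem_filter.mp ha).2 (hTL a haT)
    refine ⟨S.filter (· ∉ L) ∪ T, ?_, ?_⟩
    · rw [Finset.card_union_of_disjoint hdisj, hT, mul_add]
      have := hp.pos
      omega
    · intro a ha b hb hab k hk l hl h
      rw [Finset.mem_union, Finset.mem_filter] at ha hb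
      have hiff : a ∈ L ↔ b ∈ L := by
        rw [h, L.mul_mem_cancel_right (hKL hl), L.mul_mem_cancel_left (hKL hk)]
      rcases ha with ⟨ha, haL⟩ | ha <;> rcases hb with ⟨hb, hbL⟩ | hb
      · exact hSL a ha b hb hab k (hKL hk) l (hKL hl) h
      · exact haL (hiff.mpr (hTL b hb))
      · exact hbL (hiff.mp (hTL a ha))
      · obtain ⟨q, -, rfl⟩ := Finset.mem_image.mp ha
        obtain ⟨s, -, rfl⟩ := Finset.mem_image.mp hb
        refine hab (congrArg r ?_)
        rw [← q.out_eq', ← s.out_eq']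
        refine (QuotientGroup.eq.mpr ?_).symm
        have hconj := hnormal.conj_mem ⟨k, hKL hk⟩ hk s.out⁻¹
        have hmul := (K.subgroupOf L).mul_mem hconj (show ⟨l, hKL hl⟩ ∈ K.subgroupOf L from hl)
        convert hmul using 1
        ext
        simp only [Subgroup.coe_mul, Subgroup.coe_inv, inv_inv]
        change (r s)⁻¹ * r q = (r s)⁻¹ * k * r s * l
        rw [h]
        group

/-- In a `p`-group acting on `X`, a subgroup of index `p ^ m` that contains a point stabilizer has
at least `(p - 1) * m + 1` orbits. -/
theorem IsPGroup.exists_notMem_orbit_of_stabilizer_le {p : ℕ} [Fact p.Prime] {G X : Type*}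
    [Group G] (hG : IsPGroup p G) [MulAction G X] {x : X} {V : Subgroup G}
    (hxV : MulAction.stabilizer G x ≤ V) {m : ℕ} (hV : V.index = p ^ m) :
    ∃ f : Fin ((p - 1) * m + 1) → X, ∀ i j, i ≠ j → f i ∉ MulAction.orbit V (f j) := by
  have : V.FiniteIndex := ⟨by rw [hV]; exact pow_ne_zero _ (Fact.out : p.Prime).ne_zero⟩
  let π := QuotientGroup.mk' V.normalCore
  have hπ : Function.Surjective π := QuotientGroup.mk'_surjective _
  have hcomap : (V.map π).comap π = V :=
    Subgroup.comap_map_eq_self (by rw [QuotientGroup.ker_mk']; exact V.normalCore_le)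
  have hindex : (V.map π).index = p ^ m := by
    rw [← hV, ← Subgroup.index_comap_of_surjective _ hπ, hcomap]
  obtain ⟨S, hS, hne⟩ := (hG.to_quotient V.normalCore).exists_finset_doubleCoset_ne hindex
  obtain ⟨e⟩ := Function.Embedding.nonempty_of_card_le (α := Fin ((p - 1) * m + 1)) (β := S)
    (by simpa using hS)
  choose g hg using fun i => hπ (e i)
  refine ⟨fun i => g i • x, fun i j hij ⟨v, hv⟩ => ?_⟩
  have hstab : (g j)⁻¹ * (v : G)⁻¹ * g i ∈ MulAction.stabilizer G x := by
    replace hv : (v : G) • g j • x = g i • x := hv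
    rw [MulAction.mem_stabilizer_iff, mul_smul, ← hv]
    simp [mul_smul]
  refine hne (e i) (e i).2 (e j) (e j).2 (fun h => hij (e.injective (Subtype.ext h)))
    (π v) (Subgroup.mem_map_of_mem π v.2) _ (Subgroup.mem_map_of_mem π (hxV hstab)) ?_
  rw [← hg, ← hg, ← map_mul, ← map_mul]
  congr 1
  group

theorem MulAction.le_index_stabilizer_sup {G X : Type*} [Group G] [MulAction G X]
    [MulAction.IsPretransitive G X] (x : X) {N : Subgroup G} [N.Normal] [N.FiniteIndex] {k : ℕ}
    (f : Fin k → X) (hf : ∀ i j, i ≠ j → f i ∉ MulAction.orbit N (f j)) :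
    k ≤ (MulAction.stabilizer G x ⊔ N).index := by
  have : (MulAction.stabilizer G x ⊔ N).FiniteIndex := Subgroup.finiteIndex_of_le le_sup_right
  choose g hg using fun i => MulAction.exists_smul_eq G x (f i)
  have hinj : Function.Injective
      fun i => (g i : G ⧸ (MulAction.stabilizer G x ⊔ N)) := by
    intro i j hij
    by_contra hne
    have hmem := QuotientGroup.eq.mp hij.symm
    rw [sup_comm, ← SetLike.mem_coe, Subgroup.normal_mul] at hmem
    obtain ⟨n, hn, h, hh, hnh⟩ := hmem
    refine hf i j hne ⟨⟨g j * n * (g j)⁻¹, Subgroup.Normal.conj_mem inferInstance n hn _⟩, ?_⟩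
    change (g j * n * (g j)⁻¹) • f j = f i
    have hgi : g i = g j * n * h := by
      rw [mul_assoc]
      exact (eq_inv_mul_iff_mul_eq.mp hnh).symm
    rw [← hg i, ← hg j, hgi, mul_smul _ h, MulAction.mem_stabilizer_iff.mp hh, smul_smul,
      inv_mul_cancel_right]
  simpa [Subgroup.index] using Nat.card_le_card_of_injective _ hinj

theorem minimal_orbit_growth_of_pGroup
    (p : ℕ) (hp : p.Prime) (G X : Type*) [Group G] (hpg : IsPGroup p G)
    [MulAction G X] [MulAction.IsPretransitive G X]
    (hunb : ∀ k : ℕ, ∃ U : Subgroup G, 0 < U.index ∧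
      ∃ f : Fin k → X, ∀ i j : Fin k, i ≠ j →
        f i ∉ MulAction.orbit ↥U (f j)) :
    ∀ M : ℕ, ∃ m : ℕ, M ≤ m ∧ ∃ U : Subgroup G, U.index = p ^ m ∧
      ∃ f : Fin ((p - 1) * m + 1) → X,
        ∀ i j : Fin ((p - 1) * m + 1), i ≠ j →
          f i ∉ MulAction.orbit ↥U (f j) := by
  have : Fact p.Prime := ⟨hp⟩
  intro M
  obtain ⟨U, hU, f, hf⟩ := hunb (p ^ M)
  have : U.FiniteIndex := ⟨hU.ne'⟩
  let x := f ⟨0, pow_pos hp.pos M⟩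
  let V := MulAction.stabilizer G x ⊔ U.normalCore
  have : V.FiniteIndex := Subgroup.finiteIndex_of_le (le_sup_right : U.normalCore ≤ V)
  obtain ⟨m, hm⟩ := hpg.index V
  have hle : p ^ M ≤ V.index := MulAction.le_index_stabilizer_sup x f fun i j hij ⟨n, hn⟩ =>
    hf i j hij ⟨⟨n, U.normalCore_le n.2⟩, hn⟩
  rw [hm] at hle
  exact ⟨m, (Nat.pow_le_pow_iff_right hp.one_lt).mp hle, V, hm,
    hpg.exists_notMem_orbit_of_stabilizer_le le_sup_left hm⟩
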